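/- Let (X, Y) be jointly Gaussian real random variables, each centered with variance 1, and with correlation ρ ∈ (−1, 1), and let u ∈ ℝ. Define B(u, ρ) = (1/√(2π)) ∫_{−∞}^{u} e^{−z²/2} Φ((u − ρz)/√(1−ρ²)) dz. Then B(u, ρ) = P(X ≤ u, Y ≤ u), and the covariance of the clipped variables satisfies Cov(sgn(X − u), sgn(Y − u)) = 2·(B(u, ρ) + B(−u, ρ) + 2Φ(u)Φ(−u) − 1). -/

import Mathlib

open MeasureTheory ProbabilityTheory Real

/-- The standard normal cumulative distribution function. -/
noncomputable def stdNormalCDF (x : ℝ) : ℝ :=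
  ∫ z in Set.Iic x, (Real.sqrt (2 * Real.pi))⁻¹ * Real.exp (-z ^ 2 / 2)

/-- The function `B(u, ρ)` from the paper. -/
noncomputable def Bfun (u ρ : ℝ) : ℝ :=
  ∫ z in Set.Iic u, (Real.sqrt (2 * Real.pi))⁻¹ * Real.exp (-z ^ 2 / 2)
    * stdNormalCDF ((u - ρ * z) / Real.sqrt (1 - ρ ^ 2))

theorem stdNormalCDF_eq_measureReal_Iic (x : ℝ) :
    stdNormalCDF x = (gaussianReal 0 1).real (Set.Iic x) := by
  rw [measureReal_def, gaussianReal_apply_eq_integral 0 one_ne_zero, ENNReal.toReal_ofReal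
    (integral_nonneg fun z => gaussianPDFReal_nonneg 0 1 z)]
  simp [stdNormalCDF, gaussianPDFReal]

theorem stdNormalCDF_neg (x : ℝ) : stdNormalCDF (-x) = 1 - stdNormalCDF x := by
  have : NullSingletonClass (gaussianReal 0 1) := nullSingletonClass_gaussianReal one_ne_zero
  have hmap : (gaussianReal 0 1).map (fun y => -y) = gaussianReal 0 1 := by
    rw [gaussianReal_map_neg, neg_zero]
  have hpre : (fun y : ℝ => -y) ⁻¹' Set.Iic (-x) = Set.Ici x := by ext; simp
  rw [stdNormalCDF_eq_measureReal_Iic, stdNormalCDF_eq_measureReal_Iic,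
    ← probReal_compl_eq_one_sub measurableSet_Iic, Set.compl_Iic]
  nth_rw 1 [← hmap]
  rw [map_measureReal_apply measurable_neg measurableSet_Iic, hpre]
  exact measureReal_congr Ioi_ae_eq_Ici.symm

theorem measurableSet_correlated_le (ρ u : ℝ) :
    MeasurableSet {p : ℝ × ℝ | p.1 ≤ u ∧ ρ * p.1 + √(1 - ρ ^ 2) * p.2 ≤ u} := by
  have h : Measurable fun p : ℝ × ℝ => ρ * p.1 + √(1 - ρ ^ 2) * p.2 := by fun_prop
  exact (measurableSet_le measurable_fst measurable_const).inter
    (measurableSet_le h measurable_const)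

/-- `Bfun` is the joint distribution function of `(Z, ρ Z + √(1 - ρ²) Y')` on the diagonal. -/
theorem Bfun_eq_measureReal_prod {ρ : ℝ} (hρ : ρ ∈ Set.Ioo (-1 : ℝ) 1) (u : ℝ) :
    Bfun u ρ = ((gaussianReal 0 1).prod (gaussianReal 0 1)).real
      {p | p.1 ≤ u ∧ ρ * p.1 + √(1 - ρ ^ 2) * p.2 ≤ u} := by
  have hs : 0 < √(1 - ρ ^ 2) := Real.sqrt_pos.2 (by nlinarith [hρ.1, hρ.2])
  have hS := measurableSet_correlated_le ρ u
  rw [measureReal_def, Measure.prod_apply hS,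
    ← integral_toReal (measurable_measure_prodMk_left hS).aemeasurable
      (ae_of_all _ fun _ => measure_lt_top _ _),
    integral_gaussianReal_eq_integral_smul one_ne_zero, Bfun,
    ← integral_indicator measurableSet_Iic]
  refine integral_congr_ae (ae_of_all _ fun z => ?_)
  by_cases hz : z ≤ u
  · have hsec : Prod.mk z ⁻¹' {p : ℝ × ℝ | p.1 ≤ u ∧ ρ * p.1 + √(1 - ρ ^ 2) * p.2 ≤ u}
        = Set.Iic ((u - ρ * z) / √(1 - ρ ^ 2)) := by
      ext w
      simp only [Set.mem_preimage, Set.mem_ofPred_eq, hz, true_and, Set.mem_Iic, le_div_iff₀ hs]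
      constructor <;> intro h <;> linarith
    simp [hsec, hz, stdNormalCDF_eq_measureReal_Iic, gaussianPDFReal, measureReal_def]
  · simp [hz]

section

variable {Ω : Type*} [MeasurableSpace Ω] {μ : Measure Ω}

theorem Bfun_eq_measureReal [IsProbabilityMeasure μ] {Z Y' : Ω → ℝ}
    (hZ : HasLaw Z (gaussianReal 0 1) μ)
    (hY' : HasLaw Y' (gaussianReal 0 1) μ) (hInd : IndepFun Z Y' μ)
    {ρ : ℝ} (hρ : ρ ∈ Set.Ioo (-1 : ℝ) 1) (u : ℝ) :
    Bfun u ρ = μ.real {ω | Z ω ≤ u ∧ ρ * Z ω + √(1 - ρ ^ 2) * Y' ω ≤ u} := by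
  have hS := measurableSet_correlated_le ρ u
  have hprod := (indepFun_iff_map_prod_eq_prod_map_map hZ.aemeasurable hY'.aemeasurable).1 hInd
  rw [hZ.map_eq, hY'.map_eq] at hprod
  rw [Bfun_eq_measureReal_prod hρ, ← hprod, map_measureReal_apply_of_aemeasurable
    (hZ.aemeasurable.prodMk hY'.aemeasurable) hS]
  rfl

theorem hasLaw_correlated [IsProbabilityMeasure μ] {Z Y' : Ω → ℝ}
    (hZ : HasLaw Z (gaussianReal 0 1) μ) (hY' : HasLaw Y' (gaussianReal 0 1) μ)
    (hInd : IndepFun Z Y' μ) {ρ : ℝ} (hρ : ρ ∈ Set.Ioo (-1 : ℝ) 1) :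
    HasLaw (fun ω => ρ * Z ω + √(1 - ρ ^ 2) * Y' ω) (gaussianReal 0 1) μ := by
  have hs : 0 ≤ 1 - ρ ^ 2 := by nlinarith [hρ.1, hρ.2]
  have h := gaussianReal_add_gaussianReal_of_indepFun
    (hInd.comp (measurable_const_mul ρ) (measurable_const_mul √(1 - ρ ^ 2)))
    (gaussianReal_const_mul hZ ρ).map_eq (gaussianReal_const_mul hY' √(1 - ρ ^ 2)).map_eq
  refine ⟨by have := hZ.aemeasurable; have := hY'.aemeasurable; fun_prop, h.trans ?_⟩
  congr 1
  · simp
  · exact NNReal.eq (by simp [Real.sq_sqrt hs])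

theorem sign_sub_ae_eq {X : Ω → ℝ} {u : ℝ} (hX : ∀ᵐ ω ∂μ, X ω ≠ u) :
    (fun ω => Real.sign (X ω - u)) =ᵐ[μ] fun ω => 1 - 2 * {ω | X ω ≤ u}.indicator 1 ω := by
  filter_upwards [hX] with ω hω
  rcases lt_or_gt_of_ne hω with h | h
  · rw [Real.sign_of_neg (sub_neg.2 h), Set.indicator_of_mem (by exact h.le)]
    norm_num
  · rw [Real.sign_of_pos (sub_pos.2 h), Set.indicator_of_notMem (by simpa using h)]
    norm_num

theorem integral_sign_sub [IsProbabilityMeasure μ] {X : Ω → ℝ} (hXm : Measurable X) {u : ℝ}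
    (hX : ∀ᵐ ω ∂μ, X ω ≠ u) :
    ∫ ω, Real.sign (X ω - u) ∂μ = 1 - 2 * μ.real {ω | X ω ≤ u} := by
  have hS : MeasurableSet {ω | X ω ≤ u} := measurableSet_le hXm measurable_const
  have hf : Integrable ({ω | X ω ≤ u}.indicator (1 : Ω → ℝ)) μ :=
    (integrable_const (1 : ℝ)).indicator hS
  rw [integral_congr_ae (sign_sub_ae_eq hX), integral_sub (integrable_const _) (hf.const_mul 2),
    integral_const_mul, integral_indicator_one hS]
  simp

theorem integral_sign_sub_mul_sign_sub [IsProbabilityMeasure μ] {X Y : Ω → ℝ} (hXm : Measurable X)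
    (hYm : Measurable Y) {u : ℝ} (hX : ∀ᵐ ω ∂μ, X ω ≠ u) (hY : ∀ᵐ ω ∂μ, Y ω ≠ u) :
    ∫ ω, Real.sign (X ω - u) * Real.sign (Y ω - u) ∂μ
      = 2 * (μ.real {ω | X ω ≤ u ∧ Y ω ≤ u} + μ.real {ω | u ≤ X ω ∧ u ≤ Y ω}) - 1 := by
  have hS : MeasurableSet {ω | X ω ≤ u ∧ Y ω ≤ u} :=
    (measurableSet_le hXm measurable_const).inter (measurableSet_le hYm measurable_const)
  have hT : MeasurableSet {ω | u ≤ X ω ∧ u ≤ Y ω} :=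
    (measurableSet_le measurable_const hXm).inter (measurableSet_le measurable_const hYm)
  have hf : Integrable ({ω | X ω ≤ u ∧ Y ω ≤ u}.indicator (1 : Ω → ℝ)) μ :=
    (integrable_const (1 : ℝ)).indicator hS
  have hg : Integrable ({ω | u ≤ X ω ∧ u ≤ Y ω}.indicator (1 : Ω → ℝ)) μ :=
    (integrable_const (1 : ℝ)).indicator hT
  have h2 : Integrable (fun ω => {ω | X ω ≤ u ∧ Y ω ≤ u}.indicator (1 : Ω → ℝ) ω
      + {ω | u ≤ X ω ∧ u ≤ Y ω}.indicator 1 ω) μ := hf.add hg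
  have h : (fun ω => Real.sign (X ω - u) * Real.sign (Y ω - u)) =ᵐ[μ] fun ω =>
      2 * ({ω | X ω ≤ u ∧ Y ω ≤ u}.indicator 1 ω + {ω | u ≤ X ω ∧ u ≤ Y ω}.indicator 1 ω) - 1 := by
    filter_upwards [hX, hY] with ω hx hy
    rcases lt_or_gt_of_ne hx with h | h <;> rcases lt_or_gt_of_ne hy with h' | h' <;>
      simp [Set.indicator, Real.sign_of_neg, Real.sign_of_pos, h, h', h.le, h'.le, h.not_ge,
        h'.not_ge] <;> norm_num
  rw [integral_congr_ae h, integral_sub (h2.const_mul 2) (integrable_const _),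
    integral_const_mul, integral_add hf hg, integral_indicator_one hS, integral_indicator_one hT]
  simp

theorem measureReal_le_eq_stdNormalCDF {X : Ω → ℝ} (hX : HasLaw X (gaussianReal 0 1) μ) (u : ℝ) :
    μ.real {ω | X ω ≤ u} = stdNormalCDF u := by
  rw [stdNormalCDF_eq_measureReal_Iic, ← hX.map_eq,
    map_measureReal_apply_of_aemeasurable hX.aemeasurable measurableSet_Iic]
  rfl

theorem ae_ne_of_hasLaw_gaussianReal {X : Ω → ℝ} (hX : HasLaw X (gaussianReal 0 1) μ) (u : ℝ) :
    ∀ᵐ ω ∂μ, X ω ≠ u := by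
  have : NullSingletonClass (gaussianReal 0 1) := nullSingletonClass_gaussianReal one_ne_zero
  refine ae_of_ae_map hX.aemeasurable (p := fun x => x ≠ u) ?_
  rw [hX.map_eq]
  exact Measure.ae_ne _ u

end

theorem stmt_7 {Ω : Type*} [MeasureSpace Ω] [IsProbabilityMeasure (ℙ : Measure Ω)]
    (Z Y' : Ω → ℝ) (hZmeas : Measurable Z) (hY'meas : Measurable Y')
    (hInd : IndepFun Z Y' ℙ)
    (hZ : Measure.map Z ℙ = gaussianReal 0 1)
    (hY' : Measure.map Y' ℙ = gaussianReal 0 1)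
    (ρ : ℝ) (hρ : ρ ∈ Set.Ioo (-1 : ℝ) 1) (u : ℝ)
    (X Y : Ω → ℝ) (hX : X = Z) (hY : Y = fun ω => ρ * Z ω + Real.sqrt (1 - ρ ^ 2) * Y' ω) :
    Bfun u ρ = (ℙ {ω | X ω ≤ u ∧ Y ω ≤ u}).toReal ∧
    (∫ ω, Real.sign (X ω - u) * Real.sign (Y ω - u) ∂ℙ)
        - (∫ ω, Real.sign (X ω - u) ∂ℙ) * (∫ ω, Real.sign (Y ω - u) ∂ℙ) =
      2 * (Bfun u ρ + Bfun (-u) ρ + 2 * stdNormalCDF u * stdNormalCDF (-u) - 1) := by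
  have lawZ : HasLaw Z (gaussianReal 0 1) ℙ := ⟨hZmeas.aemeasurable, hZ⟩
  have lawY' : HasLaw Y' (gaussianReal 0 1) ℙ := ⟨hY'meas.aemeasurable, hY'⟩
  have lawX : HasLaw X (gaussianReal 0 1) ℙ := hX ▸ lawZ
  have lawY : HasLaw Y (gaussianReal 0 1) ℙ := hY ▸ hasLaw_correlated lawZ lawY' hInd hρ
  have hXm : Measurable X := hX ▸ hZmeas
  have hYm : Measurable Y := by rw [hY]; fun_prop
  have hB : Bfun u ρ = Measure.real ℙ {ω | X ω ≤ u ∧ Y ω ≤ u} := by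
    rw [Bfun_eq_measureReal lawZ lawY' hInd hρ, hX, hY]
  have hBneg : Bfun (-u) ρ = Measure.real ℙ {ω | u ≤ X ω ∧ u ≤ Y ω} := by
    have lawZn : HasLaw (-Z) (gaussianReal 0 1) ℙ := by
      simpa using gaussianReal_neg lawZ
    have lawYn : HasLaw (-Y') (gaussianReal 0 1) ℙ := by
      simpa using gaussianReal_neg lawY'
    rw [Bfun_eq_measureReal lawZn lawYn (hInd.comp measurable_neg measurable_neg) hρ, hX, hY]
    congr 1
    ext ω
    simp only [Pi.neg_apply, Set.mem_ofPred_eq, mul_neg, ← neg_add, neg_le_neg_iff]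
  have hXne := ae_ne_of_hasLaw_gaussianReal lawX u
  have hYne := ae_ne_of_hasLaw_gaussianReal lawY u
  refine ⟨hB, ?_⟩
  rw [integral_sign_sub_mul_sign_sub hXm hYm hXne hYne, integral_sign_sub hXm hXne,
    integral_sign_sub hYm hYne, measureReal_le_eq_stdNormalCDF lawX,
    measureReal_le_eq_stdNormalCDF lawY, ← hB, ← hBneg, stdNormalCDF_neg]
  ring
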